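/- Let N ≥ 1, x_j = (4^j, 4^{−j}) ∈ ℝ² for j ∈ [N], and f_j(β¹,β²) = min(⟨x_j,β¹⟩², ⟨x_j,β²⟩²). Suppose S ⊆ [N] and w : S → ℝ_{≥0} satisfy, for all β¹, β² ∈ ℝ², (1/2)·Σ_{j∈[N]} f_j(β¹,β²) ≤ Σ_{i∈S} w(i)·f_i(β¹,β²) ≤ (3/2)·Σ_{j∈[N]} f_j(β¹,β²). Then S = [N]; in particular, every 0.5-coreset for this GLSE_k instance has size at least N. -/

import Mathlib

/-- The lower-bound instance: `x_j = (4^j, 4^{−j}) ∈ ℝ²`. -/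
noncomputable def xLB (j : ℕ) : Fin 2 → ℝ := ![(4 : ℝ) ^ (j : ℤ), (4 : ℝ) ^ (-(j : ℤ))]

/-- The GLSE_k individual objective on the lower-bound instance (`T = 1`, `d = k = 2`,
`y_{j1} = 0`): `f_j(β¹,β²) = min(⟨x_j,β¹⟩², ⟨x_j,β²⟩²)`. -/
noncomputable def fLB (j : ℕ) (β1 β2 : Fin 2 → ℝ) : ℝ :=
  min ((∑ a, xLB j a * β1 a) ^ 2) ((∑ a, xLB j a * β2 a) ^ 2)

open Finset in
/-- A sum of distinct positive powers of `1 / 16` is at most `1 / 15`. -/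
lemma sum_pow_succ_le_of_injOn (T : Finset ℕ) (e : ℕ → ℕ) (he : Set.InjOn e T) :
    ∑ j ∈ T, (1 / 16 : ℝ) ^ (e j + 1) ≤ 1 / 15 := by
  have hgeo : ∑ d ∈ T.image e, (1 / 16 : ℝ) ^ d ≤ (1 - 1 / 16 : ℝ)⁻¹ := by
    rw [← tsum_geometric_of_lt_one (by norm_num) (by norm_num)]
    exact (summable_geometric_of_lt_one (by norm_num) (by norm_num)).sum_le_tsum _
      fun _ _ => by positivity
  rw [sum_image he] at hgeo
  simp_rw [pow_succ]
  rw [← sum_mul]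
  norm_num at hgeo ⊢
  linarith

lemma fLB_nonneg (j : ℕ) (β1 β2 : Fin 2 → ℝ) : 0 ≤ fLB j β1 β2 :=
  le_min (sq_nonneg _) (sq_nonneg _)

/-- The objective of individual `j` at parameters for which individual `m` dominates. -/
noncomputable def peakLB (m j : ℕ) : ℝ := fLB j ![(4 : ℝ) ^ (-(m : ℤ)), 0] ![0, (4 : ℝ) ^ (m : ℤ)]

lemma peakLB_eq (m j : ℕ) :
    peakLB m j = min (((4 : ℝ) ^ j * ((4 : ℝ) ^ m)⁻¹) ^ 2) ((((4 : ℝ) ^ j)⁻¹ * (4 : ℝ) ^ m) ^ 2) := by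
  simp [peakLB, fLB, xLB, Fin.sum_univ_two]

lemma peakLB_self (m : ℕ) : peakLB m m = 1 := by
  simp [peakLB_eq]

lemma peakLB_le_of_lt {m j : ℕ} (h : j < m) : peakLB m j ≤ (1 / 16 : ℝ) ^ (m - j - 1 + 1) := by
  obtain ⟨k, rfl⟩ := Nat.exists_eq_add_of_lt h
  rw [peakLB_eq, show j + k + 1 - j - 1 + 1 = k + 1 by omega]
  refine (min_le_left _ _).trans_eq ?_
  rw [show (1 / 16 : ℝ) = ((4 : ℝ)⁻¹) ^ 2 by norm_num, ← pow_mul, mul_comm 2, pow_mul, add_assoc,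
    pow_add]
  congr 1
  rw [inv_pow]
  field_simp

lemma peakLB_le_of_gt {m j : ℕ} (h : m < j) : peakLB m j ≤ (1 / 16 : ℝ) ^ (j - m - 1 + 1) := by
  obtain ⟨k, rfl⟩ := Nat.exists_eq_add_of_lt h
  rw [peakLB_eq, show m + k + 1 - m - 1 + 1 = k + 1 by omega]
  refine (min_le_right _ _).trans_eq ?_
  rw [show (1 / 16 : ℝ) = ((4 : ℝ)⁻¹) ^ 2 by norm_num, ← pow_mul, mul_comm 2, pow_mul, add_assoc,
    pow_add]
  congr 1
  rw [inv_pow]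
  field_simp

lemma sum_peakLB_le {m : ℕ} {T : Finset ℕ} (hm : m ∉ T) : ∑ j ∈ T, peakLB m j ≤ 2 / 15 := by
  rw [← Finset.sum_filter_add_sum_filter_not T (fun j => j < m)]
  have hlow : ∑ j ∈ T with j < m, peakLB m j ≤ 1 / 15 := by
    refine (Finset.sum_le_sum fun j hj => peakLB_le_of_lt (Finset.mem_filter.1 hj).2).trans
      (sum_pow_succ_le_of_injOn _ (fun j => m - j - 1) ?_)
    intro a ha b hb hab
    simp at ha hb hab
    omega
  have hgt : ∀ j ∈ T.filter (fun j => ¬ j < m), m < j := by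
    intro j hj
    rw [Finset.mem_filter] at hj
    exact lt_of_le_of_ne (not_lt.1 hj.2) (by rintro rfl; exact hm hj.1)
  have hhigh : ∑ j ∈ T with ¬ j < m, peakLB m j ≤ 1 / 15 := by
    refine (Finset.sum_le_sum fun j hj => peakLB_le_of_gt (hgt j hj)).trans
      (sum_pow_succ_le_of_injOn _ (fun j => j - m - 1) ?_)
    intro a ha b hb hab
    have := hgt a ha
    have := hgt b hb
    simp at hab
    omega
  linarith

/-- every 0.5-coreset on the lower-bound instance must contain all `N`
individuals; in particular it has size at least `N`. -/
theorem glsek_coreset_size_lower_bound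
    (N : ℕ) (hN : 1 ≤ N) (S : Finset ℕ) (hS : S ⊆ Finset.Icc 1 N)
    (w : ℕ → ℝ) (hw : ∀ i ∈ S, 0 ≤ w i)
    (hcore : ∀ β1 β2 : Fin 2 → ℝ,
      (1 / 2) * ∑ j ∈ Finset.Icc 1 N, fLB j β1 β2 ≤ ∑ i ∈ S, w i * fLB i β1 β2 ∧
      ∑ i ∈ S, w i * fLB i β1 β2 ≤ (3 / 2) * ∑ j ∈ Finset.Icc 1 N, fLB j β1 β2) :
    S = Finset.Icc 1 N ∧ N ≤ S.card := by
  have hpeak (m : ℕ) : (1 / 2) * ∑ j ∈ Finset.Icc 1 N, peakLB m j ≤ ∑ i ∈ S, w i * peakLB m i ∧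
      ∑ i ∈ S, w i * peakLB m i ≤ (3 / 2) * ∑ j ∈ Finset.Icc 1 N, peakLB m j := hcore _ _
  have hpos (m j : ℕ) : 0 ≤ peakLB m j := fLB_nonneg _ _ _
  have hweight : ∀ i ∈ S, w i ≤ 17 / 10 := by
    intro i hi
    have hsingle : w i * peakLB i i ≤ ∑ j ∈ S, w j * peakLB i j :=
      Finset.single_le_sum (f := fun j => w j * peakLB i j)
        (fun j hj => mul_nonneg (hw j hj) (hpos i j)) hi
    have hsum := Finset.add_sum_erase _ (peakLB i) (hS hi)
    have hrest := sum_peakLB_le (Finset.notMem_erase i (Finset.Icc 1 N))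
    have hupper := (hpeak i).2
    rw [peakLB_self] at hsingle hsum
    linarith
  have hsub : Finset.Icc 1 N ⊆ S := by
    intro m hm
    by_contra hmS
    have hone : peakLB m m ≤ ∑ j ∈ Finset.Icc 1 N, peakLB m j :=
      Finset.single_le_sum (fun j _ => hpos m j) hm
    have hcoreset : ∑ i ∈ S, w i * peakLB m i ≤ 17 / 10 * ∑ i ∈ S, peakLB m i := by
      rw [Finset.mul_sum]
      exact Finset.sum_le_sum fun i hi => mul_le_mul_of_nonneg_right (hweight i hi) (hpos m i)
    have hrest := sum_peakLB_le hmS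
    have hlower := (hpeak m).1
    rw [peakLB_self] at hone
    linarith
  have heq : S = Finset.Icc 1 N := hS.antisymm hsub
  exact ⟨heq, by simp [heq]⟩
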